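/- Let G be a stratified group with homogeneous distance d and let Σ ⊂ G be a C^1 smooth p-dimensional transversal submanifold, i.e. a submanifold of degree d(Σ) = D(p). Then the Hausdorff dimension of Σ with respect to d equals D(p). -/

import Mathlib

open Set Filter Function Module MeasureTheory
open scoped ENNReal Topology NNReal

noncomputable section

/-- A stratified (Carnot) group of step `ι`, identified with `ℝⁿ` through exponential
coordinates of the first kind adapted to a graded basis.  The coordinate `i` has degree
`deg i` (the index of the layer it belongs to); coordinates are ordered by layer.
The group operation is smooth, has the origin as identity, `-x` as inverse of `x`
(exponential coordinates of the first kind), satisfies the Baker-Campbell-Hausdorff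
grading structure, is compatible with the dilations
`δ_r x = (r^{deg i} * x i)_i`, and the layers are bracket generating:
`V_{j+1} = [V_1, V_j]`. -/
structure StratifiedGroup where
  n : ℕ
  ι : ℕ
  ι_pos : 0 < ι
  deg : Fin n → ℕ
  deg_pos : ∀ i, 1 ≤ deg i
  deg_le : ∀ i, deg i ≤ ι
  deg_surj : ∀ j, 1 ≤ j → j ≤ ι → ∃ i, deg i = j
  deg_mono : Monotone deg
  mul : (Fin n → ℝ) → (Fin n → ℝ) → (Fin n → ℝ)
  mul_assoc' : ∀ x y z, mul (mul x y) z = mul x (mul y z)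
  zero_mul' : ∀ x, mul 0 x = x
  mul_zero' : ∀ x, mul x 0 = x
  mul_neg' : ∀ x, mul x (-x) = 0
  mul_smooth : ContDiff ℝ (⊤ : ℕ∞) fun q : (Fin n → ℝ) × (Fin n → ℝ) => mul q.1 q.2
  mul_graded : ∀ x x' y y' : Fin n → ℝ, ∀ i : Fin n,
    (∀ k, deg k < deg i → x k = x' k ∧ y k = y' k) →
    mul x y i - x i - y i = mul x' y' i - x' i - y' i
  dil_mul : ∀ r : ℝ, 0 < r → ∀ x y : Fin n → ℝ, ∀ i : Fin n,
    mul (fun k => r ^ deg k * x k) (fun k => r ^ deg k * y k) i = r ^ deg i * mul x y i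
  bracket_gen : ∀ j, 1 ≤ j → j < ι → ∀ w : Fin n → ℝ,
    (∀ i, deg i ≠ j + 1 → w i = 0) →
    w ∈ Submodule.span ℝ { z : Fin n → ℝ | ∃ u v : Fin n → ℝ,
      (∀ i, deg i ≠ 1 → u i = 0) ∧ (∀ i, deg i ≠ j → v i = 0) ∧
      z = fun i => if deg i = j + 1 then mul u v i - u i - v i else 0 }

namespace StratifiedGroup

/-- The underlying space of the group, `ℝⁿ` in graded coordinates. -/
abbrev Pt (G : StratifiedGroup) : Type := Fin G.n → ℝ

variable (G : StratifiedGroup)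

/-- The intrinsic dilation `δ_r`. -/
def dil (r : ℝ) (x : G.Pt) : G.Pt := fun i => r ^ G.deg i * x i

/-- Left translation `l_x`. -/
def lTrans (x : G.Pt) : G.Pt → G.Pt := fun y => G.mul x y

/-- The left translate `x⁻¹ · S` of a set `S` (the inverse of `x` is `-x`). -/
def shift (x : G.Pt) (S : Set G.Pt) : Set G.Pt := (fun y => G.mul (-x) y) '' S

/-- `n_j`: the dimension of the `j`-th layer. -/
def nLayer (j : ℕ) : ℕ := (Finset.univ.filter fun i : Fin G.n => G.deg i = j).card

/-- `m_j = n_1 + ⋯ + n_j`. -/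
def mVal (j : ℕ) : ℕ := (Finset.univ.filter fun i : Fin G.n => G.deg i ≤ j).card

/-- Projection onto the `j`-th layer of coordinates. -/
def layerProj (j : ℕ) (x : G.Pt) : G.Pt := fun i => if G.deg i = j then x i else 0

/-- `D(p)`, the maximal dimension: the maximum of `d(α) = d_{α_1} + ⋯ + d_{α_p}` over
multi-indices `1 ≤ α_1 < ⋯ < α_p ≤ n`. -/
def maxDim (p : ℕ) : ℕ :=
  sSup {D : ℕ | ∃ α : Finset (Fin G.n), α.card = p ∧ D = ∑ i ∈ α, G.deg i}

/-- `ℓ(p)`: the largest `l ∈ [1, ι]` with `p ≤ n_l + ⋯ + n_ι`. -/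
def ellVal (p : ℕ) : ℕ :=
  sSup {l : ℕ | 1 ≤ l ∧ l ≤ G.ι ∧ p ≤ ∑ j ∈ Finset.Icc l G.ι, G.nLayer j}

/-- `r_p = p - (n_{ℓ(p)+1} + ⋯ + n_ι)`. -/
def rVal (p : ℕ) : ℕ := p - ∑ j ∈ Finset.Icc (G.ellVal p + 1) G.ι, G.nLayer j

/-- The tangent space `T_0(x⁻¹ · S)` of the translated set at the identity:
the span of the tangent cone at `0` of `x⁻¹ · S`. -/
def tangentAt (S : Set G.Pt) (x : G.Pt) : Submodule ℝ G.Pt :=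
  Submodule.span ℝ (tangentConeAt ℝ (G.shift x S) 0)

/-- The pointwise degree `d_Σ(x)` of a `p`-dimensional set `Σ = S` at `x`: the maximal
`d(α)` over multi-indices `α` such that the coefficient `c_α` of the tangent `p`-vector
is nonzero; equivalently, such that the projection of `T_0(x⁻¹·S)` onto the coordinates
in `α` is injective. -/
def pointDeg (p : ℕ) (S : Set G.Pt) (x : G.Pt) : ℕ :=
  sSup {D : ℕ | ∃ α : Finset (Fin G.n), α.card = p ∧
    (∀ v ∈ G.tangentAt S x, (∀ i ∈ α, v i = 0) → v = 0) ∧ D = ∑ i ∈ α, G.deg i}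

/-- The generalized characteristic set `Σ_c`: points of degree less than `D(p)`. -/
def charSet (p : ℕ) (S : Set G.Pt) : Set G.Pt := {x ∈ S | G.pointDeg p S x < G.maxDim p}

end StratifiedGroup

/-- A homogeneous distance on a stratified group: a continuous (for the Euclidean
topology) distance, left invariant and `1`-homogeneous with respect to dilations. -/
structure HomDistOn (G : StratifiedGroup) where
  d : G.Pt → G.Pt → ℝ
  symm : ∀ x y, d x y = d y x
  triangle : ∀ x y z, d x z ≤ d x y + d y z
  eq_zero_iff : ∀ x y, d x y = 0 ↔ x = y
  continuous : Continuous fun q : G.Pt × G.Pt => d q.1 q.2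
  left_invariant : ∀ x y z, d (G.mul z x) (G.mul z y) = d x y
  homogeneous : ∀ r : ℝ, 0 < r → ∀ x y, d (G.dil r x) (G.dil r y) = r * d x y

/-- The open ball of a homogeneous distance. -/
def HomDistOn.ball {G : StratifiedGroup} (D : HomDistOn G) (x : G.Pt) (r : ℝ) : Set G.Pt :=
  {y | D.d x y < r}

/-- Euclidean norm on `ℝⁿ` (the graded coordinates are orthonormal). -/
def eNorm {n : ℕ} (x : Fin n → ℝ) : ℝ := Real.sqrt (∑ i, x i ^ 2)

/-- Euclidean scalar product. -/
def eDot {n : ℕ} (x y : Fin n → ℝ) : ℝ := ∑ i, x i * y i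

/-- Euclidean distance. -/
def euclDist {n : ℕ} (x y : Fin n → ℝ) : ℝ := eNorm (x - y)

/-- Euclidean open ball `B_E(x, r)`. -/
def eBall {n : ℕ} (x : Fin n → ℝ) (r : ℝ) : Set (Fin n → ℝ) := {y | eNorm (y - x) < r}

/-- Diameter of a set with respect to a distance function. -/
def sdiam {α : Type*} (dist : α → α → ℝ) (A : Set α) : ℝ≥0∞ :=
  ⨆ x ∈ A, ⨆ y ∈ A, ENNReal.ofReal (dist x y)

/-- The `q`-dimensional Hausdorff measure built from the distance `dist`. -/
def hMeas {α : Type*} (dist : α → α → ℝ) (q : ℝ) (A : Set α) : ℝ≥0∞ :=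
  ⨆ (δ : ℝ≥0∞) (_ : 0 < δ),
    ⨅ (t : ℕ → Set α) (_ : A ⊆ ⋃ i, t i) (_ : ∀ i, sdiam dist (t i) ≤ δ),
      ∑' i, sdiam dist (t i) ^ q

/-- The Hausdorff dimension built from the distance `dist`:
`inf {q ≥ 0 : H^q(A) = 0}` (`∞` if there is no such exponent). -/
def hDim {α : Type*} (dist : α → α → ℝ) (A : Set α) : ℝ≥0∞ :=
  sInf {q : ℝ≥0∞ | ∃ q' : ℝ, 0 ≤ q' ∧ q = ENNReal.ofReal q' ∧ hMeas dist q' A = 0}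

/-- Hausdorff distance between two sets, with respect to a distance function. -/
def hdDist {α : Type*} (dist : α → α → ℝ) (A B : Set α) : ℝ≥0∞ :=
  max (⨆ a ∈ A, ⨅ b ∈ B, ENNReal.ofReal (dist a b))
      (⨆ b ∈ B, ⨅ a ∈ A, ENNReal.ofReal (dist a b))

/-- `(V, φ)` is a `C¹` chart (local parametrization) of the `p`-dimensional submanifold
`S ⊆ ℝⁿ`: `φ` is a `C¹` injective immersion on the open set `V`, and it is an open map
onto (a relatively open piece of) `S`. -/
def IsC1Chart (n p : ℕ) (S : Set (Fin n → ℝ)) (V : Set (Fin p → ℝ))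
    (φ : (Fin p → ℝ) → Fin n → ℝ) : Prop :=
  IsOpen V ∧ ContDiffOn ℝ 1 φ V ∧ Set.InjOn φ V ∧
  (∀ t ∈ V, Function.Injective (fderivWithin ℝ φ V t)) ∧
  (∀ W, W ⊆ V → IsOpen W → ∃ O : Set (Fin n → ℝ), IsOpen O ∧ φ '' W = S ∩ O)

/-- `S ⊆ ℝⁿ` is a `p`-dimensional `C¹` submanifold. -/
def IsC1Submanifold (n p : ℕ) (S : Set (Fin n → ℝ)) : Prop :=
  ∀ x ∈ S, ∃ V φ, IsC1Chart n p S V φ ∧ x ∈ φ '' V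

/-- A `C^{1,λ}` chart: a `C¹` chart whose differential is locally `λ`-Hölder continuous. -/
def IsHolderChart (n p : ℕ) (la : ℝ) (S : Set (Fin n → ℝ)) (V : Set (Fin p → ℝ))
    (φ : (Fin p → ℝ) → Fin n → ℝ) : Prop :=
  IsC1Chart n p S V φ ∧
  ∀ K : Set (Fin p → ℝ), IsCompact K → K ⊆ V → ∃ C : ℝ, ∀ s ∈ K, ∀ t ∈ K,
    ‖fderivWithin ℝ φ V s - fderivWithin ℝ φ V t‖ ≤ C * ‖s - t‖ ^ la

/-- `S ⊆ ℝⁿ` is a `p`-dimensional submanifold of class `C^{1,λ}`. -/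
def IsC1HolderSubmanifold (n p : ℕ) (la : ℝ) (S : Set (Fin n → ℝ)) : Prop :=
  ∀ x ∈ S, ∃ V φ, IsHolderChart n p la S V φ ∧ x ∈ φ '' V

/-- `S ⊆ ℝⁿ` is a `p`-dimensional Lipschitz submanifold: locally the graph of a
Euclidean Lipschitz map from a `p`-dimensional subspace to a complement. -/
def IsLipschitzSubmanifold (n p : ℕ) (S : Set (Fin n → ℝ)) : Prop :=
  ∀ x ∈ S, ∃ (U : Set (Fin n → ℝ)) (W V' : Submodule ℝ (Fin n → ℝ))
    (f : W → (Fin n → ℝ)) (A : Set W),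
    IsOpen U ∧ x ∈ U ∧ IsCompl W V' ∧ Module.finrank ℝ W = p ∧ IsOpen A ∧
    (∃ K : ℝ≥0, LipschitzWith K f) ∧ (∀ w, f w ∈ V') ∧
    S ∩ U = (fun w : W => (w : Fin n → ℝ) + f w) '' A

/-- The singular set `Σ_*` of a `p`-dimensional set: the points where the Euclidean
tangent cone is not a `p`-dimensional subspace. -/
def singularSet (n p : ℕ) (S : Set (Fin n → ℝ)) : Set (Fin n → ℝ) :=
  {x ∈ S | ¬ ∃ T : Submodule ℝ (Fin n → ℝ), Module.finrank ℝ T = p ∧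
    tangentConeAt ℝ S x = (T : Set (Fin n → ℝ))}

/-- The subspace of `ℝⁿ` of vectors supported on the coordinates in `s`. -/
def coordSubmodule (n : ℕ) (s : Set (Fin n)) : Submodule ℝ (Fin n → ℝ) where
  carrier := {v | ∀ i, i ∉ s → v i = 0}
  add_mem' := by
    intro a b ha hb i hi
    simp [Pi.add_apply, ha i hi, hb i hi]
  zero_mem' := by intro i _; rfl
  smul_mem' := by
    intro c a ha i hi
    simp [Pi.smul_apply, ha i hi]

/-- The Plücker coordinates (with respect to the standard basis of `Λ_p ℝⁿ`) of the
`p`-vector `v_1 ∧ ⋯ ∧ v_p`: the coordinate indexed by the multi-index `α` (a subset of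
cardinality `p`, enumerated increasingly) is the determinant of the corresponding minor. -/
def pluckerC {n p : ℕ} (v : Fin p → Fin n → ℝ) (α : Finset (Fin n)) : ℝ :=
  if h : α.card = p then
    Matrix.det (Matrix.of fun a b : Fin p => v b (α.orderIsoOfFin h a).1)
  else 0

/-- The projection `π_D` of degree `D` of a `p`-vector given in coordinates: it keeps
only the coefficients `c_α` with `d(α) = D`. -/
def projDegC {n : ℕ} (deg : Fin n → ℕ) (D : ℕ) (c : Finset (Fin n) → ℝ) :
    Finset (Fin n) → ℝ :=
  fun α => if (∑ i ∈ α, deg i) = D then c α else 0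

/-- The norm of a `p`-vector in coordinates (the standard basis of `Λ_p ℝⁿ` being
orthonormal for the graded metric). -/
def pvecNorm {n : ℕ} (c : Finset (Fin n) → ℝ) : ℝ :=
  Real.sqrt (∑ α : Finset (Fin n), (c α) ^ 2)

/-- Coefficients of the wedge product `u ∧ c` of a vector with a `p`-vector. -/
def wedgeVec {n : ℕ} (c : Finset (Fin n) → ℝ) (u : Fin n → ℝ) (β : Finset (Fin n)) : ℝ :=
  ∑ i ∈ β, (-1 : ℝ) ^ (β.filter fun j => j < i).card * u i * c (β.erase i)

/-- The subspace associated with a simple `p`-vector `c`: vectors whose wedge with `c`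
vanishes. -/
def pvecSpan {n : ℕ} (p : ℕ) (c : Finset (Fin n) → ℝ) : Set (Fin n → ℝ) :=
  {u | ∀ β : Finset (Fin n), β.card = p + 1 → wedgeVec c u β = 0}

/-- A Riemannian metric on `ℝⁿ`: a continuous family of inner products. -/
structure RiemannMetric (n : ℕ) where
  g : (Fin n → ℝ) → (Fin n → ℝ) → (Fin n → ℝ) → ℝ
  symm : ∀ x u v, g x u v = g x v u
  lin : ∀ x v, IsLinearMap ℝ fun u => g x u v
  posdef : ∀ x u, u ≠ 0 → 0 < g x u u
  cont : Continuous fun q : (Fin n → ℝ) × (Fin n → ℝ) × (Fin n → ℝ) => g q.1 q.2.1 q.2.2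

/-- The Gram determinant of the partial derivatives of a chart `φ` at `t`, with respect
to a Riemannian metric: the square of the Riemannian surface density. -/
def gramDet {n p : ℕ} (gt : RiemannMetric n) (φ : (Fin p → ℝ) → Fin n → ℝ)
    (V : Set (Fin p → ℝ)) (t : Fin p → ℝ) : ℝ :=
  Matrix.det (Matrix.of fun j k : Fin p =>
    gt.g (φ t) (fderivWithin ℝ φ V t (Pi.single j 1)) (fderivWithin ℝ φ V t (Pi.single k 1)))

/-- The tangent `p`-tuple of a chart `φ` at `t₀`, left translated to the identity:
`(dl_{φ(t₀)⁻¹})(∂_{t_j} φ(t₀))`. -/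
def tangentBasisT (G : StratifiedGroup) {p : ℕ} (V : Set (Fin p → ℝ))
    (φ : (Fin p → ℝ) → G.Pt) (t0 : Fin p → ℝ) : Fin p → G.Pt :=
  fun j => fderiv ℝ (G.lTrans (-(φ t0))) (φ t0) (fderivWithin ℝ φ V t0 (Pi.single j 1))

/-- The density of the intrinsic measure in a chart:
`‖(∂_{t_1} φ ∧ ⋯ ∧ ∂_{t_p} φ)_{D, φ(t)}‖`. -/
def intIntegrand (G : StratifiedGroup) {p : ℕ} (D : ℕ) (V : Set (Fin p → ℝ))
    (φ : (Fin p → ℝ) → G.Pt) (t : Fin p → ℝ) : ℝ :=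
  pvecNorm (projDegC G.deg D (pluckerC (tangentBasisT G V φ t)))

/-- Cumulative sums `μ_k = α_1 + ⋯ + α_k`. -/
def cumsum (α : ℕ → ℕ) (k : ℕ) : ℕ := ∑ l ∈ Finset.Icc 1 k, α l

/-- The coefficient matrix `C` of the vectors `v_j` of `T_x Σ` with respect to the graded
basis `X_i` determined by the orthogonal layer-preserving matrix `U`:
`v_j = ∑_i C_{ij} X_i(x)`, i.e. `C_{ij} = ⟨U_{·i}, dl_{x⁻¹}(v_j)⟩`. -/
def Cmat (G : StratifiedGroup) {p : ℕ} (U : Matrix (Fin G.n) (Fin G.n) ℝ)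
    (v : Fin p → G.Pt) (x : G.Pt) (i : Fin G.n) (j : Fin p) : ℝ :=
  ∑ k, U k i * fderiv ℝ (G.lTrans (-x)) x (v j) k

/-- The intrinsic integers `α_k(x)` attached to a point of a submanifold:
`α_k = dim F_k - dim F_{k+1}` where `F_k` is the subspace of the (translated) tangent
space of vectors supported in the layers of degree `≥ k`. -/
def alphaOf (G : StratifiedGroup) (p : ℕ) (S : Set G.Pt) (x : G.Pt) (k : ℕ) : ℕ :=
  Module.finrank ℝ ↥(G.tangentAt S x ⊓ coordSubmodule G.n {i | k ≤ G.deg i}) -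
  Module.finrank ℝ ↥(G.tangentAt S x ⊓ coordSubmodule G.n {i | k + 1 ≤ G.deg i})

/-- The part `Σ_{c,A}` of the generalized characteristic set. -/
def charSetA (G : StratifiedGroup) (p : ℕ) (S : Set G.Pt) : Set G.Pt :=
  {x ∈ G.charSet p S | ∃ j, G.ellVal p + 1 ≤ j ∧ j ≤ G.ι ∧ alphaOf G p S x j < G.nLayer j}

/-- The part `Σ_{c,B}` of the generalized characteristic set. -/
def charSetB (G : StratifiedGroup) (p : ℕ) (S : Set G.Pt) : Set G.Pt :=
  {x ∈ G.charSet p S | (∀ j, G.ellVal p + 1 ≤ j → j ≤ G.ι → alphaOf G p S x j = G.nLayer j)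
    ∧ alphaOf G p S x (G.ellVal p) < G.rVal p}

/-- The defining property of the threshold `r̄_ε`: for all `r < r̄_ε`, all `x ∈ S`, all
`y ∈ (x⁻¹·S) ∩ B_E(0,r)` and all unit vectors `w ⊥ T_0(x⁻¹·S)`, one has `|⟨y,w⟩| ≤ ε r`. -/
def RbarSpec (G : StratifiedGroup) (S : Set G.Pt) (ε rb : ℝ) : Prop :=
  0 < rb ∧ ∀ r : ℝ, 0 < r → r < rb → ∀ x ∈ S, ∀ y ∈ G.shift x S ∩ eBall 0 r,
    ∀ w : G.Pt, eNorm w = 1 → (∀ v ∈ G.tangentAt S x, eDot v w = 0) → |eDot y w| ≤ ε * r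

/-- `G` is (isomorphic to) the `n`-th Heisenberg group: step 2, horizontal layer of
dimension `2n`, one-dimensional center, nondegenerate bracket on the first layer. -/
def IsHeisenberg (G : StratifiedGroup) (n : ℕ) : Prop :=
  G.ι = 2 ∧ G.n = 2 * n + 1 ∧ G.nLayer 1 = 2 * n ∧ G.nLayer 2 = 1 ∧
  ∀ u : G.Pt, (∀ i, G.deg i ≠ 1 → u i = 0) → u ≠ 0 →
    ∃ v : G.Pt, (∀ i, G.deg i ≠ 1 → v i = 0) ∧
      ∃ i, G.deg i = 2 ∧ G.mul u v i - u i - v i ≠ 0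

end

/-! ### Left translations and Lebesgue measure -/

namespace StratifiedGroup

theorem neg_mul_self (G : StratifiedGroup) (x : G.Pt) : G.mul (-x) x = 0 := by
  simpa using G.mul_neg' (-x)

theorem neg_mul_cancel_left (G : StratifiedGroup) (x y : G.Pt) :
    G.mul (-x) (G.mul x y) = y := by
  rw [← G.mul_assoc', G.neg_mul_self, G.zero_mul']

theorem mul_neg_cancel_left (G : StratifiedGroup) (x y : G.Pt) :
    G.mul x (G.mul (-x) y) = y := by
  rw [← G.mul_assoc', G.mul_neg', G.zero_mul']

theorem lTrans_injective (G : StratifiedGroup) (x : G.Pt) : Injective (G.lTrans x) :=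
  LeftInverse.injective (g := G.lTrans (-x)) (G.neg_mul_cancel_left x)

theorem differentiable_lTrans (G : StratifiedGroup) (x : G.Pt) :
    Differentiable ℝ (G.lTrans x) :=
  (G.mul_smooth.differentiable (by simp)).comp
    ((differentiable_const x).prodMk differentiable_id)

/-- The differential of a left translation is injective. -/
theorem fderiv_lTrans_injective (G : StratifiedGroup) (x y : G.Pt) :
    Injective (fderiv ℝ (G.lTrans x) y) := by
  have h : HasFDerivAt (G.lTrans (-x) ∘ G.lTrans x)
      ((fderiv ℝ (G.lTrans (-x)) (G.lTrans x y)).comp (fderiv ℝ (G.lTrans x) y)) y :=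
    (G.differentiable_lTrans (-x) _).hasFDerivAt.comp y
      (G.differentiable_lTrans x y).hasFDerivAt
  have hid : G.lTrans (-x) ∘ G.lTrans x = id := funext fun z => G.neg_mul_cancel_left x z
  rw [hid] at h
  have := h.unique (hasFDerivAt_id y)
  refine LeftInverse.injective (g := fderiv ℝ (G.lTrans (-x)) (G.lTrans x y)) fun v => ?_
  exact DFunLike.congr_fun this v

theorem fderiv_lTrans_single (G : StratifiedGroup) (x y : G.Pt) {i j : Fin G.n} (hij : i ≤ j) :
    fderiv ℝ (G.lTrans x) y (Pi.single j 1) i = (Pi.single j 1 : G.Pt) i := by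
  have h := (G.differentiable_lTrans x y).hasFDerivAt.hasLineDerivAt (Pi.single j 1)
  have h1 := hasDerivAt_pi.1 h i
  have h2 : (fun τ : ℝ => G.lTrans x (y + τ • Pi.single j 1) i) =
      fun τ : ℝ => G.lTrans x y i + τ * (Pi.single j 1 : G.Pt) i := by
    funext τ
    have := G.mul_graded x x (y + τ • Pi.single j 1) y i (fun k hk => ⟨rfl, by
      have hkj : k ≠ j := fun h => absurd (G.deg_mono hij) (by rw [← h]; omega)
      simp [hkj]⟩)
    simp only [Pi.add_apply, Pi.smul_apply, smul_eq_mul] at this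
    simp only [lTrans]
    linarith
  rw [h2] at h1
  have h3 : HasDerivAt (fun τ : ℝ => G.lTrans x y i + τ * (Pi.single j 1 : G.Pt) i)
      ((Pi.single j 1 : G.Pt) i) 0 := by
    simpa using ((hasDerivAt_id (0 : ℝ)).mul_const ((Pi.single j 1 : G.Pt) i)).const_add
      (G.lTrans x y i)
  exact h1.unique h3

theorem det_fderiv_lTrans (G : StratifiedGroup) (x y : G.Pt) :
    (fderiv ℝ (G.lTrans x) y).det = 1 := by
  rw [ContinuousLinearMap.det, ← LinearMap.det_toMatrix', Matrix.det_of_isLowerTriangular]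
  · refine Finset.prod_eq_one fun i _ => ?_
    rw [LinearMap.toMatrix'_apply]
    exact (G.fderiv_lTrans_single x y le_rfl).trans (by simp)
  · intro i j hij
    have hij' : i < j := hij
    rw [LinearMap.toMatrix'_apply]
    exact (G.fderiv_lTrans_single x y hij'.le).trans (by simp [hij'.ne])

/-- Lebesgue measure is left invariant. -/
theorem volume_lTrans_image (G : StratifiedGroup) (x : G.Pt) {s : Set G.Pt}
    (hs : MeasurableSet s) : volume (G.lTrans x '' s) = volume s := by
  rw [← lintegral_abs_det_fderiv_eq_addHaar_image volume hs
    (fun y _ => (G.differentiable_lTrans x y).hasFDerivAt.hasFDerivWithinAt)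
    (G.lTrans_injective x).injOn]
  simp [det_fderiv_lTrans]

/-- On bounded sets the group law is Lipschitz. -/
theorem exists_lipschitz_mul (G : StratifiedGroup) (R : ℝ) :
    ∃ L : ℝ, 0 ≤ L ∧ ∀ x x' y y' : G.Pt, ‖x‖ ≤ R → ‖x'‖ ≤ R → ‖y‖ ≤ R → ‖y'‖ ≤ R →
      ‖G.mul x y - G.mul x' y'‖ ≤ L * max ‖x - x'‖ ‖y - y'‖ := by
  obtain ⟨K, hK⟩ := (G.mul_smooth.contDiffOn
    (s := Metric.closedBall (0 : G.Pt × G.Pt) R)).exists_lipschitzOnWith (by simp)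
    (convex_closedBall _ _) (isCompact_closedBall _ _)
  refine ⟨K, K.2, fun x x' y y' hx hx' hy hy' => ?_⟩
  have := hK.norm_sub_le (x := (x, y)) (y := (x', y')) (by simp [Prod.norm_def, hx, hy])
    (by simp [Prod.norm_def, hx', hy'])
  simpa [Prod.norm_def] using this

end StratifiedGroup

/-! ### Comparison of metric balls with boxes -/

namespace HomDistOn

variable {G : StratifiedGroup}

theorem self (D : HomDistOn G) (x : G.Pt) : D.d x x = 0 := (D.eq_zero_iff x x).2 rfl

theorem nonneg (D : HomDistOn G) (x y : G.Pt) : 0 ≤ D.d x y := by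
  have := D.triangle x y x
  rw [D.self, D.symm y x] at this
  linarith

theorem eq_zero_neg_mul (D : HomDistOn G) (x y : G.Pt) : D.d 0 (G.mul (-x) y) = D.d x y := by
  rw [← D.left_invariant 0 _ x, G.mul_zero', G.mul_neg_cancel_left]

theorem dil_zero (G : StratifiedGroup) (r : ℝ) : G.dil r 0 = 0 := by
  funext i; simp [StratifiedGroup.dil]

theorem d_zero_dil (D : HomDistOn G) {r : ℝ} (hr : 0 < r) (u : G.Pt) :
    D.d 0 (G.dil r u) = r * D.d 0 u := by
  rw [← D.homogeneous r hr, dil_zero]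

theorem continuous_right (D : HomDistOn G) (x : G.Pt) : Continuous (D.d x) :=
  D.continuous.comp (continuous_const.prodMk continuous_id)

theorem isOpen_ball (D : HomDistOn G) (x : G.Pt) (r : ℝ) : IsOpen (D.ball x r) :=
  isOpen_lt (D.continuous_right x) continuous_const

theorem lTrans_image_ball (D : HomDistOn G) (x : G.Pt) (r : ℝ) :
    G.lTrans x '' D.ball 0 r = D.ball x r := by
  ext y
  simp only [mem_image, HomDistOn.ball, mem_ofPred_eq]
  constructor
  · rintro ⟨b, hb, rfl⟩
    rwa [← D.eq_zero_neg_mul, StratifiedGroup.lTrans, G.neg_mul_cancel_left]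
  · intro hy
    exact ⟨G.mul (-x) y, by rwa [D.eq_zero_neg_mul], G.mul_neg_cancel_left x y⟩

/-- A small box is contained in the unit ball. -/
theorem exists_box_subset (D : HomDistOn G) :
    ∃ c : ℝ, 0 < c ∧ ∀ r : ℝ, 0 < r → ∀ u : G.Pt, (∀ i, |u i| ≤ c * r ^ G.deg i) →
      D.d 0 u < r := by
  have h : ∀ᶠ u in 𝓝 (0 : G.Pt), D.d 0 u < 1 :=
    (D.continuous_right 0).continuousAt.eventually_lt_const (by simp [D.self])
  obtain ⟨c, hc, hcb⟩ := Metric.nhds_basis_closedBall.eventually_iff.1 h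
  refine ⟨c, hc, fun r hr u hu => ?_⟩
  have hu' : u = G.dil r (G.dil r⁻¹ u) := by
    funext i
    simp only [StratifiedGroup.dil, inv_pow]
    field_simp
  rw [hu', D.d_zero_dil hr]
  have : D.d 0 (G.dil r⁻¹ u) < 1 := by
    refine hcb ?_
    rw [mem_closedBall_zero_iff, pi_norm_le_iff_of_nonneg hc.le]
    intro i
    simp only [StratifiedGroup.dil, norm_mul, Real.norm_eq_abs, inv_pow, abs_inv,
      abs_of_pos (pow_pos hr (G.deg i))]
    rw [inv_mul_le_iff₀ (pow_pos hr _), mul_comm]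
    exact hu i
  nlinarith

/-- A metric ball is contained in a box. -/
theorem exists_ball_subset_box (D : HomDistOn G) :
    ∃ m : ℝ, 0 < m ∧ ∀ (u : G.Pt) i, |u i| ≤ (m * D.d 0 u) ^ G.deg i := by
  obtain ⟨m, hm, hmb⟩ : ∃ m : ℝ, 0 < m ∧ ∀ u : G.Pt, ‖u‖ = 1 → m ≤ D.d 0 u := by
    rcases (Metric.sphere (0 : G.Pt) 1).eq_empty_or_nonempty with he | hne
    · refine ⟨1, one_pos, fun u hu => ?_⟩
      have : u ∈ Metric.sphere (0 : G.Pt) 1 := by simpa using hu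
      simp [he] at this
    · obtain ⟨u₀, hu₀, hmin⟩ := (isCompact_sphere (0 : G.Pt) 1).exists_isMinOn hne
        (D.continuous_right 0).continuousOn
      refine ⟨D.d 0 u₀, lt_of_le_of_ne (D.nonneg _ _) fun h => ?_, fun u hu => ?_⟩
      · have := (D.eq_zero_iff _ _).1 h.symm
        simp [← this] at hu₀
      · exact hmin (by simpa using hu)
  have key : ∀ u : G.Pt, D.d 0 u < m → ‖u‖ ≤ 1 := by
    intro u hu
    by_contra! hlt
    have hdil0 : G.dil 0 u = 0 := by
      funext i
      have := G.deg_pos i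
      simp [StratifiedGroup.dil, show G.deg i ≠ 0 by omega]
    have hcont : Continuous fun s : ℝ => ‖G.dil s u‖ := by
      unfold StratifiedGroup.dil; fun_prop
    obtain ⟨s, hs, hs1⟩ := intermediate_value_Icc (zero_le_one' ℝ) hcont.continuousOn
      (show (1 : ℝ) ∈ Icc _ _ from ⟨by simp [hdil0], by
        have : G.dil 1 u = u := by funext i; simp [StratifiedGroup.dil]
        simpa [this] using hlt.le⟩)
    have hs0 : 0 < s := by
      refine lt_of_le_of_ne hs.1 fun h => ?_
      simp [← h, hdil0] at hs1
    have h1 := hmb _ hs1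
    rw [D.d_zero_dil hs0] at h1
    have := D.nonneg 0 u
    nlinarith [hs.2]
  refine ⟨2 / m, by positivity, fun u i => ?_⟩
  rcases eq_or_lt_of_le (D.nonneg 0 u) with h0 | hpos
  · have := (D.eq_zero_iff _ _).1 h0.symm
    rw [← h0, ← this]
    simp
  · have hr : 0 < 2 / m * D.d 0 u := by positivity
    set r := 2 / m * D.d 0 u with hrdef
    have h1 : ‖G.dil r⁻¹ u‖ ≤ 1 := by
      refine key _ ?_
      rw [D.d_zero_dil (inv_pos.2 hr), hrdef]
      field_simp
      norm_num
    have h2 := (pi_norm_le_iff_of_nonneg zero_le_one).1 h1 i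
    simp only [StratifiedGroup.dil, norm_mul, Real.norm_eq_abs, inv_pow, abs_inv,
      abs_of_pos (pow_pos hr (G.deg i))] at h2
    rwa [inv_mul_le_iff₀ (pow_pos hr _), mul_one] at h2

end HomDistOn

/-! ### Hausdorff measures and coverings -/

theorem sdiam_empty {α : Type*} (dist : α → α → ℝ) : sdiam dist ∅ = 0 := by simp [sdiam]

theorem sdiam_le_of_forall {α : Type*} {dist : α → α → ℝ} {A : Set α} {r : ℝ}
    (h : ∀ x ∈ A, ∀ y ∈ A, dist x y ≤ r) : sdiam dist A ≤ ENNReal.ofReal r :=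
  iSup₂_le fun x hx => iSup₂_le fun y hy => ENNReal.ofReal_le_ofReal (h x hx y hy)

theorem ofReal_le_sdiam {α : Type*} (dist : α → α → ℝ) {A : Set α} {x y : α} (hx : x ∈ A)
    (hy : y ∈ A) : ENNReal.ofReal (dist x y) ≤ sdiam dist A :=
  le_trans (le_iSup₂ (f := fun y (_ : y ∈ A) => ENNReal.ofReal (dist x y)) y hy)
    (le_iSup₂ (f := fun x (_ : x ∈ A) => ⨆ y ∈ A, ENNReal.ofReal (dist x y)) x hx)

theorem hMeas_eq_zero_of_forall_cover {α : Type*} {dist : α → α → ℝ} {q : ℝ} (hq : 0 < q)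
    {A : Set α} (h : ∀ ε : ℝ≥0∞, 0 < ε → ∃ (ι : Type) (_ : Countable ι) (t : ι → Set α),
      A ⊆ ⋃ i, t i ∧ ∑' i, sdiam dist (t i) ^ q ≤ ε) :
    hMeas dist q A = 0 := by
  simp only [hMeas, ← nonpos_iff_eq_zero]
  refine iSup₂_le fun δ hδ => ?_
  refine le_of_forall_gt fun ε hε => ?_
  obtain ⟨ε', hε'0, hε'⟩ := exists_between hε
  obtain ⟨ι, hι, t, hA, ht⟩ := h (min ε' (δ ^ q))
    (lt_min hε'0 (ENNReal.rpow_pos_of_nonneg hδ hq.le))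
  have := Encodable.ofCountable ι
  refine lt_of_le_of_lt ?_ hε'
  have hsum := tsum_iUnion_decode₂ (fun s => sdiam dist s ^ q)
    (by simp [sdiam_empty, hq]) t
  refine iInf_le_of_le (fun i => ⋃ b ∈ Encodable.decode₂ ι i, t b) ?_
  refine iInf_le_of_le (by rwa [Encodable.iUnion_decode₂]) ?_
  refine iInf_le_of_le (fun i => ?_) ?_
  · rw [← ENNReal.rpow_le_rpow_iff hq]
    exact (ENNReal.le_tsum (f := fun i => sdiam dist (⋃ b ∈ Encodable.decode₂ ι i, t b) ^ q)
      i).trans ((hsum.le.trans ht).trans (min_le_right _ _))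
  · exact (hsum.le.trans ht).trans (min_le_left _ _)

theorem exists_cover_of_hMeas_eq_zero {α : Type*} {dist : α → α → ℝ} {q : ℝ} {A : Set α}
    (h : hMeas dist q A = 0) {δ ε : ℝ≥0∞} (hδ : 0 < δ) (hε : 0 < ε) :
    ∃ t : ℕ → Set α, A ⊆ ⋃ i, t i ∧ (∀ i, sdiam dist (t i) ≤ δ) ∧
      ∑' i, sdiam dist (t i) ^ q < ε := by
  have h1 := (le_iSup₂ (f := fun (δ : ℝ≥0∞) (_ : 0 < δ) =>
    ⨅ (t : ℕ → Set α) (_ : A ⊆ ⋃ i, t i) (_ : ∀ i, sdiam dist (t i) ≤ δ),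
      ∑' i, sdiam dist (t i) ^ q) δ hδ).trans (le_of_eq h)
  have h2 := lt_of_le_of_lt h1 hε
  simp only [iInf_lt_iff] at h2
  obtain ⟨t, hA, hd, hs⟩ := h2
  exact ⟨t, hA, hd, hs⟩

theorem hMeas_eq_zero_of_subset_iUnion {α : Type*} {ι : Type*} [Countable ι]
    {dist : α → α → ℝ} {q : ℝ} (hq : 0 < q) {A : Set α} {B : ι → Set α} (hA : A ⊆ ⋃ i, B i)
    (hB : ∀ i, hMeas dist q (B i) = 0) : hMeas dist q A = 0 := by
  refine hMeas_eq_zero_of_forall_cover hq fun ε hε => ?_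
  obtain ⟨f, hf⟩ := Countable.exists_injective_nat ι
  obtain ⟨ε', hε', hsum⟩ := ENNReal.exists_pos_sum_of_countable hε.ne' (range f)
  choose t htB _ hts using fun i => exists_cover_of_hMeas_eq_zero (hB i) (δ := 1) one_pos
    (ENNReal.coe_pos.2 (hε' ⟨f i, mem_range_self i⟩))
  let g : range f ≃ ι := (Equiv.ofInjective f hf).symm
  refine ⟨range f × ℕ, inferInstance, fun k => t (g k.1) k.2, fun x hx => ?_, ?_⟩
  · obtain ⟨i, hi⟩ := mem_iUnion.1 (hA hx)
    obtain ⟨j, hj⟩ := mem_iUnion.1 (htB i hi)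
    exact mem_iUnion.2 ⟨(g.symm i, j), by simpa using hj⟩
  · rw [ENNReal.tsum_prod']
    refine (ENNReal.tsum_le_tsum fun k => ?_).trans hsum.le
    have h := (hts (g k)).le
    have hk : (⟨f (g k), mem_range_self (g k)⟩ : range f) = k :=
      (Equiv.ofInjective f hf).apply_symm_apply k
    rwa [hk] at h

/-- If the cardinality of separated finite subsets of `K` is bounded by `N`, then `K` has a
finite net with at most `N` elements. -/
theorem exists_finset_net {β : Type*} {dist : β → β → ℝ} (hself : ∀ x, dist x x = 0)
    (hsymm : ∀ x y, dist x y = dist y x) {K : Set β} {r N : ℝ} (hr : 0 < r)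
    (hN : ∀ P : Finset β, ↑P ⊆ K → (P : Set β).Pairwise (fun x y => r ≤ dist x y) →
      (P.card : ℝ) ≤ N) :
    ∃ P : Finset β, (P.card : ℝ) ≤ N ∧ ∀ x ∈ K, ∃ y ∈ P, dist y x < r := by
  classical
  let s : Set ℕ := {k | ∃ P : Finset β, ↑P ⊆ K ∧
    (P : Set β).Pairwise (fun x y => r ≤ dist x y) ∧ P.card = k}
  have hbdd : BddAbove s := by
    refine ⟨⌊N⌋₊, ?_⟩
    rintro k ⟨P, hPK, hP, rfl⟩
    exact Nat.le_floor (hN P hPK hP)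
  obtain ⟨P, hPK, hP, hcard⟩ := Nat.sSup_mem (s := s) ⟨0, ∅, by simp, by simp, rfl⟩ hbdd
  refine ⟨P, hN P hPK hP, fun x hx => ?_⟩
  by_contra! hfar
  have hxP : x ∉ P := fun h => by
    have := hfar x h
    rw [hself] at this
    linarith
  have hmem : (insert x P).card ∈ s := by
    refine ⟨insert x P, ?_, ?_, rfl⟩
    · rw [Finset.coe_insert]
      exact insert_subset hx hPK
    · rw [Finset.coe_insert]
      refine hP.insert fun y hy _ => ⟨?_, hfar y hy⟩
      rw [hsymm]
      exact hfar y hy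
  have := le_csSup hbdd hmem
  rw [← hcard, Finset.card_insert_of_notMem hxP] at this
  omega

/-! ### Volume of tubes around a parametrized piece -/

/-- The product of a Euclidean ball of radius `r ^ l` and of a box of size `r` is contained in
the box with sides `r ^ min (deg i) l`, up to constants. -/
theorem StratifiedGroup.exists_abs_mul_le (G : StratifiedGroup) (l : ℕ) {C : ℝ} (hC : 0 ≤ C) :
    ∃ C₁ : ℝ, 0 < C₁ ∧ ∀ r : ℝ, 0 < r → r ≤ 1 → ∀ u b : G.Pt, ‖u‖ ≤ C * r ^ l →
      (∀ i, |b i| ≤ C * r ^ G.deg i) → ∀ i, |G.mul u b i| ≤ C₁ * r ^ min (G.deg i) l := by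
  obtain ⟨L, hL, hlip⟩ := G.exists_lipschitz_mul C
  refine ⟨C + L * C + 1, by positivity, fun r hr hr1 u b hu hb i => ?_⟩
  have hpow : ∀ k, r ^ k ≤ 1 := fun k => pow_le_one₀ hr.le hr1
  have hle : ∀ k, C * r ^ k ≤ C := fun k => mul_le_of_le_one_right hC (hpow k)
  have hC0 : ‖(0 : G.Pt)‖ ≤ C := by simpa using hC
  rcases le_total (G.deg i) l with hil | hil
  · rw [min_eq_left hil]
    let u₁ : G.Pt := fun k => if G.deg k ≤ G.deg i then u k / r ^ G.deg k else 0
    let b₁ : G.Pt := fun k => b k / r ^ G.deg k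
    have hu₁ : ‖u₁‖ ≤ C := by
      refine (pi_norm_le_iff_of_nonneg hC).2 fun k => ?_
      simp only [u₁]
      split_ifs with hk
      · rw [norm_div, Real.norm_of_nonneg (pow_pos hr _).le, div_le_iff₀ (pow_pos hr _)]
        refine (norm_le_pi_norm u k).trans (hu.trans ?_)
        exact mul_le_mul_of_nonneg_left (pow_le_pow_of_le_one hr.le hr1 (hk.trans hil)) hC
      · simpa using hC
    have hb₁ : ‖b₁‖ ≤ C := by
      refine (pi_norm_le_iff_of_nonneg hC).2 fun k => ?_
      simp only [b₁]
      rw [norm_div, Real.norm_of_nonneg (pow_pos hr _).le, div_le_iff₀ (pow_pos hr _)]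
      exact hb k
    have hdil := G.dil_mul r hr u₁ b₁ i
    have hgr := G.mul_graded u (fun k => r ^ G.deg k * u₁ k) b (fun k => r ^ G.deg k * b₁ k) i
      (fun k hk => ⟨by
        have := (pow_pos hr (G.deg k)).ne'
        simp only [u₁, if_pos hk.le]; field_simp, by
        have := (pow_pos hr (G.deg k)).ne'
        simp only [b₁]; field_simp⟩)
    have hui : r ^ G.deg i * u₁ i = u i := by
      have := (pow_pos hr (G.deg i)).ne'
      simp only [u₁, if_pos le_rfl]; field_simp
    have hbi : r ^ G.deg i * b₁ i = b i := by
      have := (pow_pos hr (G.deg i)).ne'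
      simp only [b₁]; field_simp
    rw [hui, hbi] at hgr
    have heq : G.mul u b i = r ^ G.deg i * G.mul u₁ b₁ i := by linarith
    rw [heq, abs_mul, abs_of_pos (pow_pos hr _), mul_comm]
    refine mul_le_mul_of_nonneg_right ?_ (pow_pos hr _).le
    have h1 := hlip u₁ 0 b₁ 0 hu₁ hC0 hb₁ hC0
    rw [G.zero_mul', sub_zero, sub_zero, sub_zero] at h1
    have h2 : |G.mul u₁ b₁ i| ≤ L * C := (norm_le_pi_norm (G.mul u₁ b₁) i).trans
      (h1.trans (mul_le_mul_of_nonneg_left (max_le hu₁ hb₁) hL))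
    linarith
  · rw [min_eq_right hil]
    have hb₁ : ‖b‖ ≤ C := (pi_norm_le_iff_of_nonneg hC).2 fun k => (hb k).trans (hle _)
    have h1 := hlip u 0 b b (hu.trans (hle _)) hC0 hb₁ hb₁
    rw [G.zero_mul', sub_zero, sub_self, norm_zero, max_eq_left (norm_nonneg u)] at h1
    have h2 : |G.mul u b i - b i| ≤ L * (C * r ^ l) :=
      (norm_le_pi_norm (G.mul u b - b) i).trans (h1.trans (mul_le_mul_of_nonneg_left hu hL))
    have h3 : |b i| ≤ C * r ^ l := (hb i).trans
      (mul_le_mul_of_nonneg_left (pow_le_pow_of_le_one hr.le hr1 hil) hC)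
    have h4 := abs_add_le (G.mul u b i - b i) (b i)
    rw [sub_add_cancel] at h4
    nlinarith [pow_pos hr l]

/-- A cube is covered by a controlled number of cubes of size `ρ`. -/
theorem exists_finset_centers {p : ℕ} (t₀ : Fin p → ℝ) {a ρ : ℝ} (ha : 0 < a) (hρ : 0 < ρ)
    (hρa : ρ ≤ a) (hρ1 : ρ ≤ 1) :
    ∃ (κ : Type) (F : Finset κ) (c : κ → Fin p → ℝ),
      (F.card : ℝ) ≤ ((2 * a + 3) / ρ) ^ p ∧ (∀ k ∈ F, c k ∈ Metric.closedBall t₀ (2 * a)) ∧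
      ∀ t ∈ Metric.closedBall t₀ a, ∃ k ∈ F, ‖t - c k‖ ≤ ρ := by
  set M : ℕ := ⌈a / ρ⌉₊ with hM
  have hM1 : a / ρ ≤ M := Nat.le_ceil _
  have hM2 : (M : ℝ) < a / ρ + 1 := Nat.ceil_lt_add_one (by positivity)
  have hMρ : ρ * M ≤ a + ρ := by
    have := mul_le_mul_of_nonneg_left hM2.le hρ.le
    rwa [mul_add, mul_one, mul_div_cancel₀ _ hρ.ne'] at this
  refine ⟨Fin p → ℤ, Fintype.piFinset fun _ => Finset.Icc (-(M : ℤ)) M,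
    fun k j => t₀ j + ρ * k j, ?_, fun k hk => ?_, fun t ht => ?_⟩
  · rw [Fintype.card_piFinset_const, Int.card_Icc]
    have : ((M : ℤ) + 1 - -(M : ℤ)).toNat = 2 * M + 1 := by omega
    rw [this]
    push_cast
    refine pow_le_pow_left₀ (by positivity) ?_ p
    rw [le_div_iff₀ hρ]
    nlinarith
  · rw [mem_closedBall_iff_norm, pi_norm_le_iff_of_nonneg (by positivity)]
    intro j
    have hkj := Finset.mem_Icc.1 (Fintype.mem_piFinset.1 hk j)
    have h1 : |(k j : ℝ)| ≤ M := by
      rw [abs_le]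
      exact ⟨by exact_mod_cast hkj.1, by exact_mod_cast hkj.2⟩
    simp only [Pi.sub_apply, add_sub_cancel_left, Real.norm_eq_abs, abs_mul, abs_of_pos hρ]
    have := mul_le_mul_of_nonneg_left h1 hρ.le
    linarith
  · rw [mem_closedBall_iff_norm, pi_norm_le_iff_of_nonneg ha.le] at ht
    refine ⟨fun j => ⌊(t j - t₀ j) / ρ⌋, Fintype.mem_piFinset.2 fun j => ?_, ?_⟩
    · have hj := abs_le.1 (ht j)
      simp only [Pi.sub_apply] at hj
      have hlo : -(M : ℝ) ≤ (t j - t₀ j) / ρ := by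
        rw [le_div_iff₀ hρ]
        rw [div_le_iff₀ hρ] at hM1
        linarith
      have hhi : (t j - t₀ j) / ρ ≤ M :=
        (div_le_div_of_nonneg_right hj.2 hρ.le).trans hM1
      rw [Finset.mem_Icc]
      constructor
      · rw [Int.le_floor]
        exact_mod_cast hlo
      · exact_mod_cast (Int.floor_le _).trans hhi
    · rw [pi_norm_le_iff_of_nonneg hρ.le]
      intro j
      have h1 := Int.floor_le ((t j - t₀ j) / ρ)
      have h2 := (Int.lt_floor_add_one ((t j - t₀ j) / ρ)).le
      rw [le_div_iff₀ hρ] at h1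
      rw [div_le_iff₀ hρ] at h2
      simp only [Pi.sub_apply, Real.norm_eq_abs]
      rw [abs_le]
      constructor <;> linarith

namespace HomDistOn

variable {G : StratifiedGroup}

/-- The volume of the tube of radius `r` around a Lipschitz parametrized piece. -/
theorem exists_volume_tube_le (D : HomDistOn G) {p : ℕ} {φ : (Fin p → ℝ) → G.Pt}
    {t₀ : Fin p → ℝ} {a : ℝ} (ha : 0 < a) {K : ℝ≥0}
    (hφ : LipschitzOnWith K φ (Metric.closedBall t₀ (2 * a))) {l : ℕ} (hl : 1 ≤ l) :
    ∃ C : ℝ, 0 < C ∧ ∀ r : ℝ, 0 < r → r ≤ 1 → r ≤ a →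
      volume (⋃ t ∈ Metric.closedBall t₀ a, D.ball (φ t) r) ≤
        ENNReal.ofReal (C / r ^ (l * p) * ∏ i, r ^ min (G.deg i) l) := by
  obtain ⟨R, hR⟩ := ((isCompact_closedBall t₀ (2 * a)).image_of_continuousOn
    hφ.continuousOn).isBounded.exists_norm_le
  have hRφ : ∀ t ∈ Metric.closedBall t₀ (2 * a), ‖φ t‖ ≤ R := fun t ht =>
    hR _ (mem_image_of_mem φ ht)
  obtain ⟨L, hL, hlip⟩ := G.exists_lipschitz_mul R
  obtain ⟨m, hm, hbox⟩ := D.exists_ball_subset_box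
  set C₀ : ℝ := max (L * K) (max 1 m ^ G.ι) with hC₀
  have hC₀0 : 0 ≤ C₀ := le_max_of_le_right (by positivity)
  obtain ⟨C₁, hC₁, hmul⟩ := G.exists_abs_mul_le l hC₀0
  refine ⟨(2 * a + 3) ^ p * (2 * C₁) ^ G.n, by positivity, fun r hr hr1 hra => ?_⟩
  have hrl : r ^ l ≤ r := pow_le_of_le_one hr.le hr1 (by omega)
  obtain ⟨κ, F, c, hcard, hc, hcov⟩ := exists_finset_centers t₀ ha (pow_pos hr l)
    (hrl.trans hra) (hrl.trans hr1)
  let E : Set G.Pt := Icc (fun i => -(C₁ * r ^ min (G.deg i) l))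
    (fun i => C₁ * r ^ min (G.deg i) l)
  have hsub : (⋃ t ∈ Metric.closedBall t₀ a, D.ball (φ t) r) ⊆
      ⋃ k ∈ F, G.lTrans (φ (c k)) '' E := by
    refine iUnion₂_subset fun t ht w hw => ?_
    obtain ⟨k, hk, hkt⟩ := hcov t ht
    have ht2 : t ∈ Metric.closedBall t₀ (2 * a) :=
      Metric.closedBall_subset_closedBall (by linarith) ht
    refine mem_iUnion₂.2 ⟨k, hk, G.mul (G.mul (-φ (c k)) (φ t)) (G.mul (-φ t) w), ?_, ?_⟩
    · have hu : ‖G.mul (-φ (c k)) (φ t)‖ ≤ C₀ * r ^ l := by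
        have h1 := hlip (-φ (c k)) (-φ (c k)) (φ t) (φ (c k)) (by simpa using hRφ _ (hc k hk))
          (by simpa using hRφ _ (hc k hk)) (hRφ t ht2) (hRφ _ (hc k hk))
        rw [G.neg_mul_self, sub_zero, sub_self, norm_zero, max_eq_right (norm_nonneg _)] at h1
        have h2 := hφ.norm_sub_le ht2 (hc k hk)
        calc _ ≤ L * (K * r ^ l) := h1.trans (mul_le_mul_of_nonneg_left
              (h2.trans (mul_le_mul_of_nonneg_left hkt K.2)) hL)
          _ = L * K * r ^ l := by ring
          _ ≤ C₀ * r ^ l := mul_le_mul_of_nonneg_right (le_max_left _ _) (pow_pos hr l).le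
      have hb : ∀ i, |G.mul (-φ t) w i| ≤ C₀ * r ^ G.deg i := fun i => by
        refine (hbox _ i).trans ?_
        rw [D.eq_zero_neg_mul, mul_pow]
        refine mul_le_mul ?_ (pow_le_pow_left₀ (D.nonneg _ _) (le_of_lt hw) _)
          (pow_nonneg (D.nonneg _ _) _) hC₀0
        refine le_trans ?_ (le_max_right _ _)
        exact (pow_le_pow_left₀ hm.le (le_max_right 1 m) _).trans
          (pow_le_pow_right₀ (le_max_left 1 m) (G.deg_le i))
      have := hmul r hr hr1 _ _ hu hb
      exact ⟨fun i => (abs_le.1 (this i)).1, fun i => (abs_le.1 (this i)).2⟩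
    · rw [G.mul_assoc', G.mul_neg_cancel_left, StratifiedGroup.lTrans, G.mul_neg_cancel_left]
  have hE : volume E = ENNReal.ofReal ((2 * C₁) ^ G.n * ∏ i, r ^ min (G.deg i) l) := by
    rw [Real.volume_Icc_pi, ← ENNReal.ofReal_prod_of_nonneg]
    · congr 1
      rw [← Fin.prod_const, ← Finset.prod_mul_distrib]
      exact Finset.prod_congr rfl fun i _ => by ring
    · intro i _
      have : 0 < C₁ * r ^ min (G.deg i) l := by positivity
      linarith
  calc _ ≤ ∑ k ∈ F, volume (G.lTrans (φ (c k)) '' E) :=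
        (measure_mono hsub).trans (measure_biUnion_finset_le _ _)
    _ = ENNReal.ofReal (F.card * ((2 * C₁) ^ G.n * ∏ i, r ^ min (G.deg i) l)) := by
        rw [Finset.sum_congr rfl fun k _ => G.volume_lTrans_image (φ (c k)) measurableSet_Icc,
          Finset.sum_const, nsmul_eq_mul, hE, ENNReal.ofReal_mul (Nat.cast_nonneg F.card),
          ENNReal.ofReal_natCast]
    _ ≤ _ := by
        refine ENNReal.ofReal_le_ofReal ?_
        refine (mul_le_mul_of_nonneg_right hcard (by positivity)).trans (le_of_eq ?_)
        rw [div_pow, ← pow_mul]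
        ring

theorem exists_volume_ball_ge (D : HomDistOn G) :
    ∃ c : ℝ, 0 < c ∧ ∀ (x : G.Pt) (r : ℝ), 0 < r →
      ENNReal.ofReal (c * ∏ i, r ^ G.deg i) ≤ volume (D.ball x r) := by
  obtain ⟨c, hc, hbox⟩ := D.exists_box_subset
  refine ⟨(2 * c) ^ G.n, by positivity, fun x r hr => ?_⟩
  rw [← D.lTrans_image_ball, G.volume_lTrans_image x (D.isOpen_ball 0 r).measurableSet]
  have hsub : Icc (fun i => -(c * r ^ G.deg i)) (fun i => c * r ^ G.deg i) ⊆ D.ball 0 r :=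
    fun u hu => hbox r hr u fun i => abs_le.2 ⟨hu.1 i, hu.2 i⟩
  refine le_trans (le_of_eq ?_) (measure_mono hsub)
  rw [Real.volume_Icc_pi, ← ENNReal.ofReal_prod_of_nonneg]
  · congr 1
    rw [← Fin.prod_const, ← Finset.prod_mul_distrib]
    exact Finset.prod_congr rfl fun i _ => by ring
  · intro i _
    have : 0 < c * r ^ G.deg i := by positivity
    linarith

/-- A Lipschitz parametrized piece has `r`-nets whose cardinality is at most of order
`r ^ (-(l * p + ∑ i, (deg i - l)⁺))`. -/
theorem exists_net (D : HomDistOn G) {p : ℕ} {φ : (Fin p → ℝ) → G.Pt}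
    {t₀ : Fin p → ℝ} {a : ℝ} (ha : 0 < a) {K : ℝ≥0}
    (hφ : LipschitzOnWith K φ (Metric.closedBall t₀ (2 * a))) {l : ℕ} (hl : 1 ≤ l) :
    ∃ C : ℝ, 0 < C ∧ ∀ r : ℝ, 0 < r → r ≤ 1 → r ≤ a →
      ∃ P : Finset (Fin p → ℝ), (P.card : ℝ) ≤ C / r ^ (l * p + ∑ i, (G.deg i - l)) ∧
        ∀ t ∈ Metric.closedBall t₀ a, ∃ s ∈ P, D.d (φ s) (φ t) < r := by
  obtain ⟨C, hC, htube⟩ := D.exists_volume_tube_le ha hφ hl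
  obtain ⟨c, hc, hball⟩ := D.exists_volume_ball_ge
  set Q := ∑ i, G.deg i with hQ
  refine ⟨C * 2 ^ Q / c, by positivity, fun r hr hr1 hra => ?_⟩
  refine exists_finset_net (dist := fun s t => D.d (φ s) (φ t)) (fun _ => D.self _)
    (fun _ _ => D.symm _ _) hr fun P hPK hP => ?_
  have hdisj : (P : Set (Fin p → ℝ)).PairwiseDisjoint fun t => D.ball (φ t) (r / 2) := by
    intro s hs t ht hst
    refine Set.disjoint_left.2 fun w (hw : D.d _ _ < _) (hw' : D.d _ _ < _) => ?_
    have h1 := hP hs ht hst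
    have h2 := D.triangle (φ s) w (φ t)
    rw [D.symm w] at h2
    linarith
  have hvol : ENNReal.ofReal (P.card * (c * ∏ i, (r / 2) ^ G.deg i)) ≤
      ENNReal.ofReal (C / r ^ (l * p) * ∏ i, r ^ min (G.deg i) l) := by
    refine le_trans ?_ (htube r hr hr1 hra)
    calc _ = ∑ t ∈ P, ENNReal.ofReal (c * ∏ i, (r / 2) ^ G.deg i) := by
          rw [Finset.sum_const, nsmul_eq_mul, ENNReal.ofReal_mul (by positivity),
            ENNReal.ofReal_natCast]
      _ ≤ ∑ t ∈ P, volume (D.ball (φ t) (r / 2)) :=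
          Finset.sum_le_sum fun t _ => hball _ _ (by positivity)
      _ = volume (⋃ t ∈ P, D.ball (φ t) (r / 2)) :=
          (measure_biUnion_finset hdisj fun t _ => (D.isOpen_ball _ _).measurableSet).symm
      _ ≤ _ := measure_mono (iUnion₂_subset fun t ht w (hw : D.d _ _ < _) =>
          mem_iUnion₂.2 ⟨t, hPK ht, show D.d _ _ < _ by linarith⟩)
  rw [ENNReal.ofReal_le_ofReal_iff (by positivity), Finset.prod_pow_eq_pow_sum,
    Finset.prod_pow_eq_pow_sum, ← hQ] at hvol
  have hsum : Q = ∑ i, min (G.deg i) l + ∑ i, (G.deg i - l) := by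
    rw [hQ, ← Finset.sum_add_distrib]
    exact Finset.sum_congr rfl fun i _ => by omega
  have hsplit : r ^ Q = r ^ (∑ i, min (G.deg i) l) * r ^ (∑ i, (G.deg i - l)) := by
    rw [hsum, pow_add]
  rw [div_pow, hsplit] at hvol
  rw [pow_add]
  have h1 : 0 < r ^ (∑ i, min (G.deg i) l) := pow_pos hr _
  have h2 : 0 < r ^ (∑ i, (G.deg i - l)) := pow_pos hr _
  have h3 : 0 < r ^ (l * p) := pow_pos hr _
  have h4 : (0 : ℝ) < 2 ^ Q := by positivity
  generalize r ^ (∑ i, min (G.deg i) l) = A at *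
  generalize r ^ (∑ i, (G.deg i - l)) = B at *
  generalize r ^ (l * p) = Z at *
  generalize (2 : ℝ) ^ Q = T at *
  rw [div_mul_eq_mul_div, le_div_iff₀ h3] at hvol
  rw [le_div_iff₀ (by positivity), le_div_iff₀ hc]
  have h5 : (P.card : ℝ) * (Z * B) * c * (A / T) ≤ C * T * (A / T) := by
    calc _ = ↑P.card * (c * (A * B / T)) * Z := by ring
      _ ≤ C * A := hvol
      _ = _ := by field_simp
  exact le_of_mul_le_mul_right h5 (by positivity)

/-- Images of small cubes under a Lipschitz parametrization are null for the
`q`-dimensional Hausdorff measure as soon as `q > l * p + ∑ i, (deg i - l)⁺`. -/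
theorem hMeas_image_eq_zero (D : HomDistOn G) {p : ℕ} {φ : (Fin p → ℝ) → G.Pt}
    {t₀ : Fin p → ℝ} {a : ℝ} (ha : 0 < a) {K : ℝ≥0}
    (hφ : LipschitzOnWith K φ (Metric.closedBall t₀ (2 * a))) {l : ℕ} (hl : 1 ≤ l) {q : ℝ}
    (hq : ((l * p + ∑ i, (G.deg i - l) : ℕ) : ℝ) < q) :
    hMeas D.d q (φ '' Metric.closedBall t₀ a) = 0 := by
  obtain ⟨C, hC, hnet⟩ := D.exists_net ha hφ hl
  set N := l * p + ∑ i, (G.deg i - l)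
  have hq0 : 0 < q := lt_of_le_of_lt (Nat.cast_nonneg _) hq
  refine hMeas_eq_zero_of_forall_cover hq0 fun ε hε => ?_
  have hlim : Tendsto (fun r : ℝ => ENNReal.ofReal (C * 2 ^ q * r ^ (q - N))) (𝓝 0) (𝓝 0) := by
    have h1 : ContinuousAt (fun r : ℝ => C * 2 ^ q * r ^ (q - N)) 0 :=
      continuousAt_const.mul (Real.continuousAt_rpow_const _ _ (Or.inr (by linarith)))
    have h2 := ENNReal.tendsto_ofReal h1.tendsto
    simpa [Real.zero_rpow (by linarith : q - N ≠ 0)] using h2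
  obtain ⟨δ, hδ, hδε⟩ := Metric.nhds_basis_ball.eventually_iff.1 (hlim.eventually_le_const hε)
  obtain ⟨r, hr, hrlt⟩ := exists_between (lt_min (lt_min one_pos ha) hδ)
  have hr1 : r ≤ 1 := hrlt.le.trans ((min_le_left _ _).trans (min_le_left _ _))
  have hra : r ≤ a := hrlt.le.trans ((min_le_left _ _).trans (min_le_right _ _))
  have hrδ : r < δ := hrlt.trans_le (min_le_right _ _)
  obtain ⟨P, hcard, hP⟩ := hnet r hr hr1 hra
  have hdiam : ∀ x, sdiam D.d (D.ball x r) ≤ ENNReal.ofReal (2 * r) := fun x =>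
    sdiam_le_of_forall fun y (hy : D.d _ _ < _) z (hz : D.d _ _ < _) => by
      have := D.triangle y x z
      rw [D.symm y x] at this
      linarith
  let e := P.equivFin
  refine ⟨Fin P.card, inferInstance, fun k => D.ball (φ (e.symm k)) r, ?_, ?_⟩
  · rintro _ ⟨t, ht, rfl⟩
    obtain ⟨s, hs, hst⟩ := hP t ht
    exact mem_iUnion.2 ⟨e ⟨s, hs⟩, show D.d _ _ < _ by simpa using hst⟩
  · calc _ ≤ ∑' _ : Fin P.card, ENNReal.ofReal (2 * r) ^ q :=
          ENNReal.tsum_le_tsum fun k => ENNReal.rpow_le_rpow (hdiam _) hq0.le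
      _ = ENNReal.ofReal (P.card * (2 * r) ^ q) := by
          rw [tsum_fintype, Finset.sum_const, nsmul_eq_mul, Finset.card_fin,
            ENNReal.ofReal_rpow_of_pos (by positivity), ENNReal.ofReal_mul (by positivity),
            ENNReal.ofReal_natCast]
      _ ≤ ENNReal.ofReal (C * 2 ^ q * r ^ (q - N)) := by
          refine ENNReal.ofReal_le_ofReal ((mul_le_mul_of_nonneg_right hcard
            (by positivity)).trans (le_of_eq ?_))
          rw [Real.mul_rpow (by norm_num) hr.le, Real.rpow_sub hr, Real.rpow_natCast]
          ring
      _ ≤ ε := hδε (by simpa [abs_of_pos hr] using hrδ)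

end HomDistOn

/-! ### The upper bound -/

namespace StratifiedGroup

theorem sum_deg_le_maxDim (G : StratifiedGroup) (α : Finset (Fin G.n)) :
    ∑ i ∈ α, G.deg i ≤ G.maxDim α.card := by
  refine le_csSup ⟨∑ i, G.deg i, ?_⟩ ⟨α, rfl, rfl⟩
  rintro _ ⟨β, -, rfl⟩
  exact Finset.sum_le_sum_of_subset (Finset.subset_univ β)

/-- `D(p)` dominates `l p + ∑ i, (deg i - l)⁺` when `l` is the degree of the `p`-th coordinate
from the end. -/
theorem exists_le_maxDim (G : StratifiedGroup) {p : ℕ} (hp : p ≤ G.n) :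
    ∃ l, 1 ≤ l ∧ l * p + ∑ i, (G.deg i - l) ≤ G.maxDim p := by
  rcases Nat.eq_zero_or_pos p with rfl | hp0
  · refine ⟨G.ι, G.ι_pos, ?_⟩
    simp [Nat.sub_eq_zero_of_le (G.deg_le _)]
  · let i₀ : Fin G.n := ⟨G.n - p, by omega⟩
    have hcard : (Finset.Ici i₀).card = p := by
      rw [Fin.card_Ici]
      simp only [i₀]
      omega
    refine ⟨G.deg i₀, G.deg_pos i₀, ?_⟩
    have h := G.sum_deg_le_maxDim (Finset.Ici i₀)
    rw [hcard] at h
    refine le_trans (le_of_eq ?_) h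
    have hsub : ∑ i ∈ Finset.Ici i₀, (G.deg i - G.deg i₀) = ∑ i, (G.deg i - G.deg i₀) :=
      Finset.sum_subset (Finset.subset_univ _) fun i _ hi => by
        have hlt : i < i₀ := by simpa using hi
        have := G.deg_mono hlt.le
        omega
    rw [← hsub, mul_comm]
    nth_rewrite 1 [← hcard]
    rw [← smul_eq_mul, ← Finset.sum_const, ← Finset.sum_add_distrib]
    refine Finset.sum_congr rfl fun i hi => ?_
    have := G.deg_mono (Finset.mem_Ici.1 hi)
    omega

end StratifiedGroup

theorem IsC1Chart.le_dim {n p : ℕ} {S : Set (Fin n → ℝ)} {V : Set (Fin p → ℝ)}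
    {φ : (Fin p → ℝ) → Fin n → ℝ} (h : IsC1Chart n p S V φ) {t : Fin p → ℝ} (ht : t ∈ V) :
    p ≤ n := by
  simpa using LinearMap.finrank_le_finrank_of_injective
    (f := (fderivWithin ℝ φ V t : (Fin p → ℝ) →ₗ[ℝ] Fin n → ℝ)) (h.2.2.2.1 t ht)

theorem IsC1Chart.subset {n p : ℕ} {S : Set (Fin n → ℝ)} {V : Set (Fin p → ℝ)}
    {φ : (Fin p → ℝ) → Fin n → ℝ} (h : IsC1Chart n p S V φ) : φ '' V ⊆ S := by
  obtain ⟨O, -, hO⟩ := h.2.2.2.2 V Subset.rfl h.1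
  rw [hO]
  exact inter_subset_left

/-- Every point of a `C¹` submanifold has a neighborhood parametrized by a Lipschitz map on a
cube. -/
theorem IsC1Submanifold.exists_lipschitz_param {n p : ℕ} {S : Set (Fin n → ℝ)}
    (hS : IsC1Submanifold n p S) {x : Fin n → ℝ} (hx : x ∈ S) :
    ∃ (φ : (Fin p → ℝ) → Fin n → ℝ) (t₀ : Fin p → ℝ) (a : ℝ) (K : ℝ≥0), 0 < a ∧
      LipschitzOnWith K φ (Metric.closedBall t₀ (2 * a)) ∧
      φ '' Metric.closedBall t₀ a ∈ 𝓝[S] x := by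
  obtain ⟨V, φ, hφ, t₀, ht₀, rfl⟩ := hS x hx
  obtain ⟨b, hb, hbV⟩ := Metric.nhds_basis_closedBall.mem_iff.1 (hφ.1.mem_nhds ht₀)
  obtain ⟨K, hK⟩ := (hφ.2.1.mono hbV).exists_lipschitzOnWith one_ne_zero
    (convex_closedBall _ _) (isCompact_closedBall _ _)
  refine ⟨φ, t₀, b / 2, K, by positivity, by rwa [mul_div_cancel₀ b two_ne_zero], ?_⟩
  have hsub : Metric.ball t₀ (b / 2) ⊆ Metric.closedBall t₀ b :=
    Metric.ball_subset_closedBall.trans (Metric.closedBall_subset_closedBall (by linarith))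
  obtain ⟨O, hO, hOeq⟩ := hφ.2.2.2.2 _ (hsub.trans hbV) Metric.isOpen_ball
  have ht₀O : φ t₀ ∈ S ∩ O :=
    hOeq ▸ mem_image_of_mem φ (Metric.mem_ball_self (by positivity))
  refine mem_of_superset (inter_mem_nhdsWithin S (hO.mem_nhds ht₀O.2)) ?_
  rw [← hOeq]
  exact image_mono Metric.ball_subset_closedBall

theorem HomDistOn.hMeas_eq_zero_of_lt {G : StratifiedGroup} (D : HomDistOn G) {p : ℕ}
    {S : Set G.Pt} (hS : IsC1Submanifold G.n p S) {l : ℕ} (hl : 1 ≤ l) {q : ℝ}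
    (hq : ((l * p + ∑ i, (G.deg i - l) : ℕ) : ℝ) < q) : hMeas D.d q S = 0 := by
  choose! φ t₀ a K ha hK hnhds using fun x (hx : x ∈ S) => hS.exists_lipschitz_param hx
  obtain ⟨c, hcS, hc, hcov⟩ := TopologicalSpace.countable_cover_nhdsWithin hnhds
  have := hc.to_subtype
  rw [biUnion_eq_iUnion] at hcov
  exact hMeas_eq_zero_of_subset_iUnion (lt_of_le_of_lt (Nat.cast_nonneg _) hq) hcov fun x =>
    D.hMeas_image_eq_zero (ha x (hcS x.2)) (hK x (hcS x.2)) hl hq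

theorem HomDistOn.hDim_le_maxDim {G : StratifiedGroup} (D : HomDistOn G) {p : ℕ}
    {S : Set G.Pt} (hS : IsC1Submanifold G.n p S) (hp : p ≤ G.n) :
    hDim D.d S ≤ ENNReal.ofReal (G.maxDim p) := by
  obtain ⟨l, hl, hle⟩ := G.exists_le_maxDim hp
  refine ENNReal.le_of_forall_pos_le_add fun ε hε _ => ?_
  have hle' : ((l * p + ∑ i, (G.deg i - l) : ℕ) : ℝ) ≤ G.maxDim p := by exact_mod_cast hle
  have hε' : (0 : ℝ) < ε := hε
  refine sInf_le ⟨G.maxDim p + ε, by positivity, ?_,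
    D.hMeas_eq_zero_of_lt hS hl (by linarith)⟩
  rw [ENNReal.ofReal_add (by positivity) hε'.le, ENNReal.ofReal_coe_nnreal]

/-! ### The lower bound -/

/-- The translated differential of a chart takes values in the translated tangent space. -/
theorem StratifiedGroup.fderiv_mem_tangentAt (G : StratifiedGroup) {p : ℕ} {S : Set G.Pt}
    {V : Set (Fin p → ℝ)} {φ : (Fin p → ℝ) → G.Pt} (hφ : IsC1Chart G.n p S V φ)
    {t₀ : Fin p → ℝ} (ht₀ : t₀ ∈ V) (v : Fin p → ℝ) :
    fderiv ℝ (G.lTrans (-φ t₀)) (φ t₀) (fderivWithin ℝ φ V t₀ v) ∈ G.tangentAt S (φ t₀) := by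
  have hd : HasFDerivWithinAt (G.lTrans (-φ t₀) ∘ φ)
      ((fderiv ℝ (G.lTrans (-φ t₀)) (φ t₀)).comp (fderivWithin ℝ φ V t₀)) V t₀ :=
    (G.differentiable_lTrans (-φ t₀) _).hasFDerivAt.comp_hasFDerivWithinAt t₀
      (hφ.2.1.differentiableOn one_ne_zero t₀ ht₀).hasFDerivWithinAt
  have hmem := hd.mapsTo_tangent_cone
    (show v ∈ tangentConeAt ℝ V t₀ by simp [tangentConeAt_of_mem_nhds (hφ.1.mem_nhds ht₀)])
  have h0 : (G.lTrans (-φ t₀) ∘ φ) t₀ = 0 := G.neg_mul_self (φ t₀)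
  have hsub : (G.lTrans (-φ t₀) ∘ φ) '' V ⊆ G.shift (φ t₀) S := by
    rw [image_comp]
    exact image_mono hφ.subset
  rw [h0] at hmem
  exact Submodule.subset_span (tangentConeAt_mono hsub hmem)

/-- Near a point whose translated tangent space projects injectively onto the coordinates `α`,
the parametrized measure of sets of small diameter `r` is at most of order `r ^ d(α)`. -/
theorem HomDistOn.exists_volume_preimage_le {G : StratifiedGroup} (D : HomDistOn G) {p : ℕ}
    {S : Set G.Pt} {V : Set (Fin p → ℝ)} {φ : (Fin p → ℝ) → G.Pt}
    (hφ : IsC1Chart G.n p S V φ) {t₀ : Fin p → ℝ} (ht₀ : t₀ ∈ V) {α : Finset (Fin G.n)}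
    (hα : α.card = p)
    (hinj : ∀ v ∈ G.tangentAt S (φ t₀), (∀ i ∈ α, v i = 0) → v = 0) :
    ∃ W ∈ 𝓝 t₀, W ⊆ V ∧ ∃ C : ℝ, 0 < C ∧ ∀ r : ℝ, 0 ≤ r → ∀ A ⊆ W,
      (∀ s ∈ A, ∀ t ∈ A, D.d (φ s) (φ t) ≤ r) →
      volume A ≤ ENNReal.ofReal (C * r ^ ∑ i ∈ α, G.deg i) := by
  let e := α.orderIsoOfFin hα
  let π : G.Pt →L[ℝ] Fin p → ℝ :=
    ContinuousLinearMap.pi fun j => ContinuousLinearMap.proj (e j : Fin G.n)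
  let Θ : (Fin p → ℝ) × (Fin p → ℝ) → Fin p → ℝ := fun z => π (G.mul (-φ z.1) (φ z.2))
  have hφc : ContDiffAt ℝ 1 φ t₀ := hφ.2.1.contDiffAt (hφ.1.mem_nhds ht₀)
  have hΘ : ContDiffAt ℝ 1 Θ (t₀, t₀) := by
    refine π.contDiff.contDiffAt.comp (t₀, t₀) ?_
    refine ((G.mul_smooth.of_le (by exact_mod_cast le_top)).contDiffAt).comp (t₀, t₀)
      (f := fun z : (Fin p → ℝ) × (Fin p → ℝ) => (-φ z.1, φ z.2)) ?_
    exact (ContDiffAt.comp (t₀, t₀) (f := Prod.fst) hφc contDiffAt_fst).neg.prodMk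
      (ContDiffAt.comp (t₀, t₀) (f := Prod.snd) hφc contDiffAt_snd)
  let B : (Fin p → ℝ) →L[ℝ] Fin p → ℝ :=
    (fderiv ℝ Θ (t₀, t₀)).comp (ContinuousLinearMap.inr ℝ _ _)
  have hB : ∀ v, B v = π (fderiv ℝ (G.lTrans (-φ t₀)) (φ t₀) (fderivWithin ℝ φ V t₀ v)) := by
    have h1 : HasFDerivAt (fun t => Θ (t₀, t)) B t₀ :=
      (hΘ.differentiableAt one_ne_zero).hasFDerivAt.comp t₀ (hasFDerivAt_prodMk_right t₀ t₀)
    have h2 : HasFDerivAt (fun t => Θ (t₀, t))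
        (π.comp ((fderiv ℝ (G.lTrans (-φ t₀)) (φ t₀)).comp (fderivWithin ℝ φ V t₀))) t₀ := by
      refine π.hasFDerivAt.comp t₀ ?_
      refine (G.differentiable_lTrans (-φ t₀) _).hasFDerivAt.comp t₀ ?_
      rw [fderivWithin_of_mem_nhds (hφ.1.mem_nhds ht₀)]
      exact (hφc.differentiableAt one_ne_zero).hasFDerivAt
    exact fun v => DFunLike.congr_fun (h1.unique h2) v
  have hBinj : ∀ v, B v = 0 → v = 0 := by
    intro v hv
    rw [hB] at hv
    have h0 := hinj _ (G.fderiv_mem_tangentAt hφ ht₀ v) fun i hi => by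
      have := congrFun hv (e.symm ⟨i, hi⟩)
      simpa [π] using this
    have h1 := G.fderiv_lTrans_injective _ _ (h0.trans (map_zero _).symm)
    exact hφ.2.2.2.1 t₀ ht₀ (h1.trans (map_zero _).symm)
  have hdet : B.det ≠ 0 := by
    have hu : IsUnit (B : (Fin p → ℝ) →ₗ[ℝ] Fin p → ℝ) :=
      (LinearMap.isUnit_iff_ker_eq_bot _).2 (LinearMap.ker_eq_bot'.2 hBinj)
    exact (LinearMap.isUnit_iff_isUnit_det _).1 hu |>.ne_zero
  set μ₀ : ℝ≥0 := Real.toNNReal (|B.det| / 2) with hμ₀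
  have habs : 0 < |B.det| := abs_pos.2 hdet
  have hμ₀pos : 0 < μ₀ := Real.toNNReal_pos.2 (by positivity)
  have hμ₀lt : (μ₀ : ℝ≥0∞) < ENNReal.ofReal |B.det| := by
    rw [hμ₀]
    exact (ENNReal.ofReal_lt_ofReal_iff habs).2 (half_lt_self habs)
  obtain ⟨δ, hδ, hδ0⟩ :=
    ((mul_le_addHaar_image_of_lt_det volume B hμ₀lt).and self_mem_nhdsWithin).exists
  obtain ⟨Z, hZ, happrox⟩ := (hΘ.hasStrictFDerivAt one_ne_zero).approximates_deriv_on_nhds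
    (c := δ) (Or.inr hδ0)
  obtain ⟨W, hW, hWZ⟩ : ∃ W ∈ 𝓝 t₀, W ×ˢ W ⊆ Z := by
    rw [nhds_prod_eq] at hZ
    exact mem_prod_self_iff.1 hZ
  obtain ⟨m, hm, hbox⟩ := D.exists_ball_subset_box
  refine ⟨W ∩ V, inter_mem hW (hφ.1.mem_nhds ht₀), inter_subset_right,
    (μ₀ : ℝ)⁻¹ * (2 ^ p * m ^ ∑ i ∈ α, G.deg i), by positivity, fun r hr A hA hAr => ?_⟩
  rcases A.eq_empty_or_nonempty with rfl | ⟨s, hs⟩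
  · simp
  have hlin : ApproximatesLinearOn (fun t => Θ (s, t)) B A δ := by
    intro t ht t' ht'
    have := happrox (s, t) (hWZ ⟨(hA hs).1, (hA ht).1⟩) (s, t') (hWZ ⟨(hA hs).1, (hA ht').1⟩)
    simpa [B, Prod.norm_def] using this
  have hvol := hδ A _ hlin
  have himage : (fun t => Θ (s, t)) '' A ⊆
      Icc (fun j => -(m * r) ^ G.deg (e j)) (fun j => (m * r) ^ G.deg (e j)) := by
    rintro _ ⟨t, ht, rfl⟩
    have hj : ∀ j, |Θ (s, t) j| ≤ (m * r) ^ G.deg (e j) := fun j => by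
      refine (hbox (G.mul (-φ s) (φ t)) (e j)).trans ?_
      rw [D.eq_zero_neg_mul]
      exact pow_le_pow_left₀ (mul_nonneg hm.le (D.nonneg _ _))
        (mul_le_mul_of_nonneg_left (hAr s hs t ht) hm.le) _
    exact ⟨fun j => (abs_le.1 (hj j)).1, fun j => (abs_le.1 (hj j)).2⟩
  have hsum : ∑ j, G.deg (e j) = ∑ i ∈ α, G.deg i := by
    rw [← Finset.sum_coe_sort α]
    exact Equiv.sum_comp e.toEquiv fun i : α => G.deg i
  have hbound : volume ((fun t => Θ (s, t)) '' A) ≤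
      ENNReal.ofReal (2 ^ p * (m * r) ^ ∑ i ∈ α, G.deg i) := by
    refine (measure_mono himage).trans (le_of_eq ?_)
    rw [Real.volume_Icc_pi, ← ENNReal.ofReal_prod_of_nonneg]
    · congr 1
      rw [← hsum, ← Finset.prod_pow_eq_pow_sum, ← Fin.prod_const, ← Finset.prod_mul_distrib]
      exact Finset.prod_congr rfl fun j _ => by ring
    · intro j _
      have : 0 ≤ (m * r) ^ G.deg (e j) := by positivity
      linarith
  have hμ₀ne : (μ₀ : ℝ≥0∞) ≠ 0 := by exact_mod_cast hμ₀pos.ne'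
  calc volume A ≤ (μ₀ : ℝ≥0∞)⁻¹ * ENNReal.ofReal (2 ^ p * (m * r) ^ ∑ i ∈ α, G.deg i) := by
        rw [mul_comm, ← div_eq_mul_inv, ENNReal.le_div_iff_mul_le (Or.inl hμ₀ne)
          (Or.inl ENNReal.coe_ne_top), mul_comm]
        exact hvol.trans hbound
    _ = _ := by
        rw [← ENNReal.coe_inv hμ₀pos.ne', ← ENNReal.ofReal_coe_nnreal,
          ← ENNReal.ofReal_mul (NNReal.coe_nonneg _), NNReal.coe_inv, mul_pow]
        congr 1
        ring

theorem HomDistOn.hMeas_ne_zero {G : StratifiedGroup} (D : HomDistOn G) {p : ℕ}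
    {S : Set G.Pt} {V : Set (Fin p → ℝ)} {φ : (Fin p → ℝ) → G.Pt}
    (hφ : IsC1Chart G.n p S V φ) {t₀ : Fin p → ℝ} (ht₀ : t₀ ∈ V) {α : Finset (Fin G.n)}
    (hα : α.card = p)
    (hinj : ∀ v ∈ G.tangentAt S (φ t₀), (∀ i ∈ α, v i = 0) → v = 0) {q : ℝ}
    (hq : q ≤ (∑ i ∈ α, G.deg i : ℕ)) : hMeas D.d q S ≠ 0 := by
  intro h0
  obtain ⟨W, hW, hWV, C, hC, hvol⟩ := D.exists_volume_preimage_le hφ ht₀ hα hinj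
  set N := ∑ i ∈ α, G.deg i
  have hWpos : volume W ≠ 0 := (Measure.measure_pos_of_mem_nhds volume hW).ne'
  have hCne : ENNReal.ofReal C ≠ 0 := by simpa using hC
  obtain ⟨t, hSt, hdiam, hsum⟩ := exists_cover_of_hMeas_eq_zero h0 one_pos
    (ENNReal.div_pos hWpos (ENNReal.ofReal_ne_top (r := C)))
  have hpiece : ∀ i, volume (W ∩ φ ⁻¹' t i) ≤ ENNReal.ofReal C * sdiam D.d (t i) ^ q := by
    intro i
    have hfin : sdiam D.d (t i) ≠ ⊤ := ne_top_of_le_ne_top ENNReal.one_ne_top (hdiam i)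
    refine (hvol (sdiam D.d (t i)).toReal ENNReal.toReal_nonneg _ inter_subset_left
      fun s hs s' hs' => ?_).trans ?_
    · rw [← ENNReal.ofReal_le_iff_le_toReal hfin]
      exact ofReal_le_sdiam D.d hs.2 hs'.2
    · rw [ENNReal.ofReal_mul hC.le, ENNReal.ofReal_pow ENNReal.toReal_nonneg,
        ENNReal.ofReal_toReal hfin, ← ENNReal.rpow_natCast]
      exact mul_le_mul_right (ENNReal.rpow_le_rpow_of_exponent_ge (hdiam i) hq) _
  have hcov : W ⊆ ⋃ i, W ∩ φ ⁻¹' t i := fun s hs => by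
    obtain ⟨i, hi⟩ := mem_iUnion.1 (hSt (hφ.subset (mem_image_of_mem φ (hWV hs))))
    exact mem_iUnion.2 ⟨i, hs, hi⟩
  have hle : volume W ≤ ENNReal.ofReal C * ∑' i, sdiam D.d (t i) ^ q := by
    rw [← ENNReal.tsum_mul_left]
    exact (measure_mono hcov).trans ((measure_iUnion_le _).trans (ENNReal.tsum_le_tsum hpiece))
  rw [ENNReal.lt_div_iff_mul_lt (Or.inl hCne) (Or.inl ENNReal.ofReal_ne_top), mul_comm] at hsum
  exact absurd hle (not_le.2 hsum)

/-- The pointwise degree, when positive, is realized by a multi-index. -/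
theorem StratifiedGroup.exists_pointDeg_eq (G : StratifiedGroup) {p : ℕ} {S : Set G.Pt}
    {x : G.Pt} (h : G.pointDeg p S x ≠ 0) :
    ∃ α : Finset (Fin G.n), α.card = p ∧
      (∀ v ∈ G.tangentAt S x, (∀ i ∈ α, v i = 0) → v = 0) ∧
      G.pointDeg p S x = ∑ i ∈ α, G.deg i := by
  refine Nat.sSup_mem (s := {D : ℕ | ∃ α : Finset (Fin G.n), α.card = p ∧
    (∀ v ∈ G.tangentAt S x, (∀ i ∈ α, v i = 0) → v = 0) ∧ D = ∑ i ∈ α, G.deg i})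
    (nonempty_iff_ne_empty.2 fun he => h ?_) ⟨∑ i, G.deg i, ?_⟩
  · rw [pointDeg, he, csSup_empty, bot_eq_zero]
  · rintro _ ⟨β, -, -, rfl⟩
    exact Finset.sum_le_sum_of_subset (Finset.subset_univ β)

/-- **Hausdorff dimension of transversal submanifolds.**
Let `Σ` be a `C¹` smooth `p`-dimensional transversal submanifold of a stratified group
`G` (i.e. a submanifold of degree `d(Σ) = D(p)`; the pointwise degree never exceeds
`D(p)`, so transversality means that it is attained at some point).  Then the Hausdorff
dimension of `Σ` with respect to any homogeneous distance `d` equals `D(p)`. -/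
theorem statement5 (G : StratifiedGroup) (D : HomDistOn G) (p : ℕ) (S : Set G.Pt)
    (hS : IsC1Submanifold G.n p S)
    (htransversal : ∃ x ∈ S, G.pointDeg p S x = G.maxDim p) :
    hDim D.d S = ENNReal.ofReal (G.maxDim p) := by
  obtain ⟨x, hx, hdeg⟩ := htransversal
  obtain ⟨V, φ, hφ, t₀, ht₀, rfl⟩ := hS x hx
  refine le_antisymm (D.hDim_le_maxDim hS (hφ.le_dim ht₀)) (le_sInf ?_)
  rintro _ ⟨q, hq0, rfl, hq⟩
  refine ENNReal.ofReal_le_ofReal ?_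
  rcases Nat.eq_zero_or_pos (G.maxDim p) with h0 | hpos
  · simpa [h0] using hq0
  · obtain ⟨α, hα, hinj, hsum⟩ := G.exists_pointDeg_eq (hdeg.trans_ne hpos.ne')
    by_contra! hlt
    rw [← hdeg, hsum] at hlt
    exact D.hMeas_ne_zero hφ ht₀ hα hinj hlt.le hq
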